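/- For every trilocal chain model, define T₀₀ = (1/8)⟨(a¹_0+a¹_1) a²_0 a³_0 (a⁴_0+a⁴_1)⟩, T₀₁ = (1/8)⟨(a¹_0+a¹_1) a²_0 a³_1 (a⁴_0−a⁴_1)⟩, T₁₀ = (1/8)⟨(a¹_0−a¹_1) a²_1 a³_0 (a⁴_0+a⁴_1)⟩, and T₁₁ = −(1/8)⟨(a¹_0−a¹_1) a²_1 a³_1 (a⁴_0−a⁴_1)⟩. Then there exist q, r ∈ [0,1] such that, writing q₀ = q, q₁ = 1−q, r₀ = r, r₁ = 1−r: for each (s,t) ∈ {0,1}², either q_s·r_t > 0 or T_{st} = 0; and Σ over those (s,t) with q_s·r_t > 0 of T_{st}/(q_s·r_t) is at most 1. -/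

import Mathlib

open MeasureTheory

lemma chsh_le_two {a b c d : ℝ} (ha : |a| ≤ 1) (hb : |b| ≤ 1) (hc : |c| ≤ 1) (hd : |d| ≤ 1) :
    a * c + a * d + b * c - b * d ≤ 2 := by
  have h₁ : a * (c + d) ≤ |c + d| := (le_abs_self _).trans <| by
    rw [abs_mul]; exact mul_le_of_le_one_left (abs_nonneg _) ha
  have h₂ : b * (c - d) ≤ |c - d| := (le_abs_self _).trans <| by
    rw [abs_mul]; exact mul_le_of_le_one_left (abs_nonneg _) hb
  have h₃ : |c + d| + |c - d| ≤ 2 := by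
    rw [abs_le] at hc hd
    rcases abs_cases (c + d) with h | h <;> rcases abs_cases (c - d) with h' | h' <;> linarith
  linarith

lemma abs_div_le_one_of_abs_le {x q : ℝ} (h : |x| ≤ q) : |x / q| ≤ 1 := by
  rw [abs_div]
  exact div_le_one_of_le₀ (h.trans (le_abs_self q)) (abs_nonneg q)

section Averages

variable {α β γ : Type*} [MeasurableSpace α] [MeasurableSpace β] [MeasurableSpace γ]

lemma integrable_mul_of_abs_le {μ : Measure β} [IsFiniteMeasure μ] {f g : β → ℝ} {q r : ℝ}
    (hf : StronglyMeasurable f) (hg : StronglyMeasurable g)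
    (hfq : ∀ y, |f y| ≤ q) (hgr : ∀ y, |g y| ≤ r) : Integrable (fun y => f y * g y) μ :=
  Integrable.of_bound (hf.mul hg).aestronglyMeasurable (q * r) <| .of_forall fun y => by
    rw [Real.norm_eq_abs, abs_mul]
    exact mul_le_mul (hfq y) (hgr y) (abs_nonneg _) ((abs_nonneg _).trans (hfq y))

lemma integral_mul_eq_zero_of_abs_le {μ : Measure β} {f g : β → ℝ} {q r : ℝ}
    (hfq : ∀ y, |f y| ≤ q) (hgr : ∀ y, |g y| ≤ r) (h : q * r = 0) :
    ∫ y, f y * g y ∂μ = 0 := by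
  refine integral_eq_zero_of_ae (.of_forall fun y => ?_)
  rcases mul_eq_zero.mp h with rfl | rfl
  · simp [abs_nonpos_iff.mp (hfq y)]
  · simp [abs_nonpos_iff.mp (hgr y)]

/-- The CHSH inequality for averages rescaled by upper bounds on their absolute values. -/
lemma chsh_integral_le_two (μ : Measure β) [IsProbabilityMeasure μ] {f g : Fin 2 → β → ℝ}
    {q r : Fin 2 → ℝ} (hf : ∀ s, StronglyMeasurable (f s)) (hg : ∀ t, StronglyMeasurable (g t))
    (hfq : ∀ s y, |f s y| ≤ q s) (hgr : ∀ t y, |g t y| ≤ r t) :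
    (∫ y, f 0 y * g 0 y ∂μ) / (q 0 * r 0) + (∫ y, f 0 y * g 1 y ∂μ) / (q 0 * r 1)
      + (∫ y, f 1 y * g 0 y ∂μ) / (q 1 * r 0) - (∫ y, f 1 y * g 1 y ∂μ) / (q 1 * r 1) ≤ 2 := by
  have hi (s t) : Integrable (fun y => f s y * g t y / (q s * r t)) μ :=
    (integrable_mul_of_abs_le (hf s) (hg t) (hfq s) (hgr t)).div_const _
  simp only [← integral_div]
  rw [← integral_add' (hi 0 0) (hi 0 1), ← integral_add' ((hi 0 0).add (hi 0 1)) (hi 1 0),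
    ← integral_sub' (((hi 0 0).add (hi 0 1)).add (hi 1 0)) (hi 1 1)]
  calc _ ≤ ∫ _, (2 : ℝ) ∂μ := by
        refine integral_mono ((((hi 0 0).add (hi 0 1)).add (hi 1 0)).sub (hi 1 1))
          (integrable_const _) fun y => ?_
        have h := chsh_le_two (abs_div_le_one_of_abs_le (hfq 0 y))
          (abs_div_le_one_of_abs_le (hfq 1 y)) (abs_div_le_one_of_abs_le (hgr 0 y))
          (abs_div_le_one_of_abs_le (hgr 1 y))
        simp only [div_mul_div_comm] at h
        exact h
    _ = 2 := by simp

lemma abs_integral_mul_le_integral_abs {μ : Measure α} {u h : α → ℝ}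
    (hh : ∀ x, |h x| = 1) : |∫ x, u x * h x ∂μ| ≤ ∫ x, |u x| ∂μ :=
  abs_integral_le_integral_abs.trans_eq <| integral_congr_ae <| .of_forall fun x => by
    simp [abs_mul, hh]

/-- Integrating a product along a chain of independent sources factors at the middle source. -/
lemma integral_chain_eq (μ : Measure α) (ν : Measure β) (ξ : Measure γ)
    [IsProbabilityMeasure μ] [IsProbabilityMeasure ν] [IsProbabilityMeasure ξ]
    {u : α → ℝ} {h : α → β → ℝ} {k : β → γ → ℝ} {v : γ → ℝ} {C D : ℝ}
    (hu : Measurable u) (hh : Measurable fun p : α × β => h p.1 p.2)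
    (hk : Measurable fun p : β × γ => k p.1 p.2) (hv : Measurable v)
    (huC : ∀ x, |u x| ≤ C) (hh₁ : ∀ x y, |h x y| = 1) (hk₁ : ∀ y z, |k y z| = 1)
    (hvD : ∀ z, |v z| ≤ D) :
    ∫ p, u p.1 * h p.1 p.2.1 * k p.2.1 p.2.2 * v p.2.2 ∂(μ.prod (ν.prod ξ))
      = ∫ y, (∫ x, u x * h x y ∂μ) * (∫ z, v z * k y z ∂ξ) ∂ν := by
  have hint : Integrable (fun p : α × β × γ =>
      u p.1 * h p.1 p.2.1 * (v p.2.2 * k p.2.1 p.2.2)) (μ.prod (ν.prod ξ)) := by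
    refine integrable_mul_of_abs_le (q := C) (r := D) ?_ ?_ ?_ ?_
    · exact Measurable.stronglyMeasurable <| (hu.comp measurable_fst).mul
        (hh.comp (measurable_fst.prodMk (measurable_fst.comp measurable_snd)))
    · exact Measurable.stronglyMeasurable <|
        (hv.comp (measurable_snd.comp measurable_snd)).mul (hk.comp measurable_snd)
    · intro p; simpa [abs_mul, hh₁] using huC p.1
    · intro p; simpa [abs_mul, hk₁] using hvD p.2.2
  calc _ = ∫ p, u p.1 * h p.1 p.2.1 * (v p.2.2 * k p.2.1 p.2.2) ∂(μ.prod (ν.prod ξ)) := by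
        congr 1; ext p; ring
    _ = _ := by
        rw [integral_prod_symm _ hint, integral_prod _ hint.integral_prod_right]
        simp only [integral_mul_const, integral_const_mul]

end Averages

/-- The sum and the difference of two functions. -/
def sumDiff {α : Type*} (a : Fin 2 → α → ℝ) (s : Fin 2) (x : α) : ℝ :=
  if s = 0 then a 0 x + a 1 x else a 0 x - a 1 x

section SumDiff

variable {α : Type*} {a : Fin 2 → α → ℝ}

lemma abs_sumDiff_le_two (ha : ∀ s x, a s x = 1 ∨ a s x = -1) (s : Fin 2) (x : α) :
    |sumDiff a s x| ≤ 2 := by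
  unfold sumDiff
  rcases ha 0 x with h₀ | h₀ <;> rcases ha 1 x with h₁ | h₁ <;> split_ifs <;>
    norm_num [h₀, h₁]

lemma abs_sumDiff_zero_add_one (ha : ∀ s x, a s x = 1 ∨ a s x = -1) (x : α) :
    |sumDiff a 0 x| + |sumDiff a 1 x| = 2 := by
  rcases ha 0 x with h₀ | h₀ <;> rcases ha 1 x with h₁ | h₁ <;> norm_num [sumDiff, h₀, h₁]

variable [MeasurableSpace α]

lemma measurable_sumDiff (ha : ∀ s, Measurable (a s)) (s : Fin 2) : Measurable (sumDiff a s) := by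
  unfold sumDiff
  split_ifs
  · exact (ha 0).add (ha 1)
  · exact (ha 0).sub (ha 1)

lemma integrable_sumDiff (μ : Measure α) [IsFiniteMeasure μ] (hm : ∀ s, Measurable (a s))
    (ha : ∀ s x, a s x = 1 ∨ a s x = -1) (s : Fin 2) : Integrable (sumDiff a s) μ :=
  Integrable.of_bound (measurable_sumDiff hm s).aestronglyMeasurable 2 <|
    .of_forall fun x => abs_sumDiff_le_two ha s x

lemma integral_abs_sumDiff_zero_add_one (μ : Measure α) [IsProbabilityMeasure μ]
    (hm : ∀ s, Measurable (a s)) (ha : ∀ s x, a s x = 1 ∨ a s x = -1) :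
    ∫ x, |sumDiff a 0 x| ∂μ + ∫ x, |sumDiff a 1 x| ∂μ = 2 := by
  rw [← integral_add (integrable_sumDiff μ hm ha 0).abs (integrable_sumDiff μ hm ha 1).abs]
  simp [abs_sumDiff_zero_add_one ha]

end SumDiff

/-- For every trilocal chain model (three independent sources, four parties in a line,
measurable ±1-valued responses), defining
`T₀₀ = (1/8)⟨(a¹_0+a¹_1) a²_0 a³_0 (a⁴_0+a⁴_1)⟩`, `T₀₁ = (1/8)⟨(a¹_0+a¹_1) a²_0 a³_1 (a⁴_0−a⁴_1)⟩`,
`T₁₀ = (1/8)⟨(a¹_0−a¹_1) a²_1 a³_0 (a⁴_0+a⁴_1)⟩`, `T₁₁ = −(1/8)⟨(a¹_0−a¹_1) a²_1 a³_1 (a⁴_0−a⁴_1)⟩`,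
there exist `q, r ∈ [0,1]` such that, with `q₀ = q, q₁ = 1−q, r₀ = r, r₁ = 1−r`:
for each `(s,t)`, either `q_s·r_t > 0` or `T_{st} = 0`; and the sum over those `(s,t)` with
`q_s·r_t > 0` of `T_{st}/(q_s·r_t)` is at most `1`. -/
theorem trilocal_quantifier_inequality
    {Λ₁ Λ₂ Λ₃ : Type} [MeasurableSpace Λ₁] [MeasurableSpace Λ₂] [MeasurableSpace Λ₃]
    (ρ₁ : Measure Λ₁) (ρ₂ : Measure Λ₂) (ρ₃ : Measure Λ₃)
    [IsProbabilityMeasure ρ₁] [IsProbabilityMeasure ρ₂] [IsProbabilityMeasure ρ₃]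
    (a₁ : Fin 2 → Λ₁ → ℝ) (a₂ : Fin 2 → Λ₁ → Λ₂ → ℝ)
    (a₃ : Fin 2 → Λ₂ → Λ₃ → ℝ) (a₄ : Fin 2 → Λ₃ → ℝ)
    (ha₁_meas : ∀ x, Measurable (a₁ x))
    (ha₂_meas : ∀ x, Measurable (fun p : Λ₁ × Λ₂ => a₂ x p.1 p.2))
    (ha₃_meas : ∀ x, Measurable (fun p : Λ₂ × Λ₃ => a₃ x p.1 p.2))
    (ha₄_meas : ∀ x, Measurable (a₄ x))
    (ha₁_val : ∀ x l₁, a₁ x l₁ = 1 ∨ a₁ x l₁ = -1)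
    (ha₂_val : ∀ x l₁ l₂, a₂ x l₁ l₂ = 1 ∨ a₂ x l₁ l₂ = -1)
    (ha₃_val : ∀ x l₂ l₃, a₃ x l₂ l₃ = 1 ∨ a₃ x l₂ l₃ = -1)
    (ha₄_val : ∀ x l₃, a₄ x l₃ = 1 ∨ a₄ x l₃ = -1)
    (T : Fin 2 → Fin 2 → ℝ)
    (hT₀₀ : T 0 0 = (1/8) * ∫ p, (a₁ 0 p.1 + a₁ 1 p.1) * a₂ 0 p.1 p.2.1 * a₃ 0 p.2.1 p.2.2
        * (a₄ 0 p.2.2 + a₄ 1 p.2.2) ∂(ρ₁.prod (ρ₂.prod ρ₃)))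
    (hT₀₁ : T 0 1 = (1/8) * ∫ p, (a₁ 0 p.1 + a₁ 1 p.1) * a₂ 0 p.1 p.2.1 * a₃ 1 p.2.1 p.2.2
        * (a₄ 0 p.2.2 - a₄ 1 p.2.2) ∂(ρ₁.prod (ρ₂.prod ρ₃)))
    (hT₁₀ : T 1 0 = (1/8) * ∫ p, (a₁ 0 p.1 - a₁ 1 p.1) * a₂ 1 p.1 p.2.1 * a₃ 0 p.2.1 p.2.2
        * (a₄ 0 p.2.2 + a₄ 1 p.2.2) ∂(ρ₁.prod (ρ₂.prod ρ₃)))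
    (hT₁₁ : T 1 1 = -(1/8) * ∫ p, (a₁ 0 p.1 - a₁ 1 p.1) * a₂ 1 p.1 p.2.1 * a₃ 1 p.2.1 p.2.2
        * (a₄ 0 p.2.2 - a₄ 1 p.2.2) ∂(ρ₁.prod (ρ₂.prod ρ₃))) :
    ∃ q r : ℝ, q ∈ Set.Icc (0:ℝ) 1 ∧ r ∈ Set.Icc (0:ℝ) 1 ∧
      (∀ s t : Fin 2,
        0 < (if s = 0 then q else 1 - q) * (if t = 0 then r else 1 - r) ∨ T s t = 0) ∧
      (∑ s : Fin 2, ∑ t : Fin 2,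
          if 0 < (if s = 0 then q else 1 - q) * (if t = 0 then r else 1 - r)
          then T s t / ((if s = 0 then q else 1 - q) * (if t = 0 then r else 1 - r))
          else 0) ≤ 1 := by
  set Q : Fin 2 → ℝ := fun s => ∫ x, |sumDiff a₁ s x| ∂ρ₁
  set R : Fin 2 → ℝ := fun t => ∫ z, |sumDiff a₄ t z| ∂ρ₃
  set F : Fin 2 → Λ₂ → ℝ := fun s y => ∫ x, sumDiff a₁ s x * a₂ s x y ∂ρ₁
  set G : Fin 2 → Λ₂ → ℝ := fun t y => ∫ z, sumDiff a₄ t z * a₃ t y z ∂ρ₃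
  have abs_a₂ (s x y) : |a₂ s x y| = 1 := by rcases ha₂_val s x y with h | h <;> simp [h]
  have abs_a₃ (t y z) : |a₃ t y z| = 1 := by rcases ha₃_val t y z with h | h <;> simp [h]
  have hFQ (s y) : |F s y| ≤ Q s := abs_integral_mul_le_integral_abs fun x => abs_a₂ s x y
  have hGR (t y) : |G t y| ≤ R t := abs_integral_mul_le_integral_abs fun z => abs_a₃ t y z
  have hFm (s) : StronglyMeasurable (F s) := StronglyMeasurable.integral_prod_left'
    (f := fun p : Λ₁ × Λ₂ => sumDiff a₁ s p.1 * a₂ s p.1 p.2)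
    (((measurable_sumDiff ha₁_meas s).comp measurable_fst).mul (ha₂_meas s)).stronglyMeasurable
  have hGm (t) : StronglyMeasurable (G t) := StronglyMeasurable.integral_prod_right'
    (f := fun p : Λ₂ × Λ₃ => sumDiff a₄ t p.2 * a₃ t p.1 p.2)
    (((measurable_sumDiff ha₄_meas t).comp measurable_snd).mul (ha₃_meas t)).stronglyMeasurable
  have chain (s t) := integral_chain_eq ρ₁ ρ₂ ρ₃ (measurable_sumDiff ha₁_meas s) (ha₂_meas s)
    (ha₃_meas t) (measurable_sumDiff ha₄_meas t) (abs_sumDiff_le_two ha₁_val s) (abs_a₂ s)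
    (abs_a₃ t) (abs_sumDiff_le_two ha₄_val t)
  replace hT₀₀ : T 0 0 = (1/8) * ∫ y, F 0 y * G 0 y ∂ρ₂ := hT₀₀.trans (by rw [← chain]; rfl)
  replace hT₀₁ : T 0 1 = (1/8) * ∫ y, F 0 y * G 1 y ∂ρ₂ := hT₀₁.trans (by rw [← chain]; rfl)
  replace hT₁₀ : T 1 0 = (1/8) * ∫ y, F 1 y * G 0 y ∂ρ₂ := hT₁₀.trans (by rw [← chain]; rfl)
  replace hT₁₁ : T 1 1 = -(1/8) * ∫ y, F 1 y * G 1 y ∂ρ₂ := hT₁₁.trans (by rw [← chain]; rfl)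
  have hQ₀ (s) : 0 ≤ Q s := integral_nonneg fun _ => abs_nonneg _
  have hR₀ (t) : 0 ≤ R t := integral_nonneg fun _ => abs_nonneg _
  have hQ₂ : Q 0 + Q 1 = 2 := integral_abs_sumDiff_zero_add_one ρ₁ ha₁_meas ha₁_val
  have hR₂ : R 0 + R 1 = 2 := integral_abs_sumDiff_zero_add_one ρ₃ ha₄_meas ha₄_val
  have hq (s : Fin 2) : (if s = 0 then Q 0 / 2 else 1 - Q 0 / 2) = Q s / 2 := by
    fin_cases s <;> simp; linarith
  have hr (t : Fin 2) : (if t = 0 then R 0 / 2 else 1 - R 0 / 2) = R t / 2 := by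
    fin_cases t <;> simp; linarith
  have hT_zero (s t) (h : Q s * R t = 0) : T s t = 0 := by
    have := integral_mul_eq_zero_of_abs_le (μ := ρ₂) (hFQ s) (hGR t) h
    fin_cases s <;> fin_cases t <;> simp_all
  have hpos (s t) : 0 < Q s / 2 * (R t / 2) ∨ T s t = 0 := by
    rcases (mul_nonneg (hQ₀ s) (hR₀ t)).eq_or_lt with h | h
    · exact .inr (hT_zero s t h.symm)
    · exact .inl (by linarith)
  refine ⟨Q 0 / 2, R 0 / 2, ⟨by linarith [hQ₀ 0], by linarith [hQ₀ 1]⟩,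
    ⟨by linarith [hR₀ 0], by linarith [hR₀ 1]⟩, ?_, ?_⟩
  · simpa only [hq, hr] using hpos
  · have hterm (s t) : (if 0 < Q s / 2 * (R t / 2) then T s t / (Q s / 2 * (R t / 2)) else 0)
        = 4 * (T s t / (Q s * R t)) := by
      split_ifs with h
      · rw [div_mul_div_comm, div_div_eq_mul_div]; ring
      · simp [(hpos s t).resolve_left h]
    simp only [hq, hr, hterm, Fin.sum_univ_two, hT₀₀, hT₀₁, hT₁₀, hT₁₁, mul_div_assoc]
    linarith [chsh_integral_le_two ρ₂ hFm hGm hFQ hGR]
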